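/- Encoding preserves subtyping (soundness direction of the subtyping theorem): for all session-π types T and T', if T <: T' in the session subtyping relation then ⟦T⟧ ≤ ⟦T'⟧ in the subtyping relation of the standard linear π-calculus. -/

import Mathlib

/-! Session types and standard linear π-types, duality, encoding. -/

namespace SessionPi

mutual
/-- Session types: `end`, `!T.S`, `?T.S`, select `⊕{lᵢ : Sᵢ}_{i∈I}`, branch `&{lᵢ : Sᵢ}_{i∈I}`.
Labels are natural numbers; the index set `I` is a finite set of labels. -/
inductive SType : Type
  | done : SType                                   -- end
  | send : Ty → SType → SType                      -- !T.S
  | recv : Ty → SType → SType                      -- ?T.S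
  | sel  : (I : Finset ℕ) → (∀ i ∈ I, SType) → SType  -- ⊕{lᵢ : Sᵢ}
  | bra  : (I : Finset ℕ) → (∀ i ∈ I, SType) → SType  -- &{lᵢ : Sᵢ}

/-- Types: session types, standard channel types `#T`, `Unit`. -/
inductive Ty : Type
  | session : SType → Ty
  | chan : Ty → Ty
  | unit : Ty
end

/-- Duality on session types. -/
def dual : SType → SType
  | .done => .done
  | .send T S => .recv T (dual S)
  | .recv T S => .send T (dual S)
  | .sel I f => .bra I (fun i h => dual (f i h))
  | .bra I f => .sel I (fun i h => dual (f i h))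

/-- Linear π-types: `ℓo[t̄]`, `ℓi[t̄]`, `∅[]`, variants, connections `#[t̄]`, `Unit`. -/
inductive PiTy : Type
  | lout : (n : ℕ) → (Fin n → PiTy) → PiTy           -- ℓo[t₁,…,tₙ]
  | lin  : (n : ℕ) → (Fin n → PiTy) → PiTy           -- ℓi[t₁,…,tₙ]
  | noCap : PiTy                                      -- ∅[]
  | variant : (I : Finset ℕ) → (∀ i ∈ I, PiTy) → PiTy -- ⟨lᵢ : tᵢ⟩
  | conn : (n : ℕ) → (Fin n → PiTy) → PiTy            -- #[t₁,…,tₙ]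
  | unit : PiTy

/-- The (partial) involution `overline` swapping the outermost input/output capability. -/
def flipCap : PiTy → PiTy
  | .lin n ts => .lout n ts
  | .lout n ts => .lin n ts
  | t => t

mutual
/-- Encoding of session types into linear π-types:
`⟦end⟧ = ∅[]`, `⟦!T.S⟧ = ℓo[⟦T⟧,⟦dual S⟧]`, `⟦?T.S⟧ = ℓi[⟦T⟧,⟦S⟧]`,
`⟦⊕{lᵢ:Sᵢ}⟧ = ℓo[⟨lᵢ:⟦dual Sᵢ⟧⟩]`, `⟦&{lᵢ:Sᵢ}⟧ = ℓi[⟨lᵢ:⟦Sᵢ⟧⟩]`.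
(`encDS` implements `S ↦ ⟦dual S⟧`; see `encDS_eq` below.) -/
def encS : SType → PiTy
  | .done => .noCap
  | .send T S => .lout 2 ![encTy T, encDS S]
  | .recv T S => .lin 2 ![encTy T, encS S]
  | .sel I f => .lout 1 ![.variant I (fun i h => encDS (f i h))]
  | .bra I f => .lin 1 ![.variant I (fun i h => encS (f i h))]

/-- `encDS S = encS (dual S)` (proved below in `encDS_eq`). -/
def encDS : SType → PiTy
  | .done => .noCap
  | .send T S => .lin 2 ![encTy T, encDS S]
  | .recv T S => .lout 2 ![encTy T, encS S]
  | .sel I f => .lin 1 ![.variant I (fun i h => encDS (f i h))]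
  | .bra I f => .lout 1 ![.variant I (fun i h => encS (f i h))]

/-- Encoding of types, homomorphic on non-session constructs. -/
def encTy : Ty → PiTy
  | .session S => encS S
  | .chan T => .conn 1 ![encTy T]
  | .unit => .unit
end

theorem encDS_eq : ∀ S : SType, encDS S = encS (dual S) ∧ encDS (dual S) = encS S := by
  intro S
  induction S using SType.rec (motive_2 := fun _ => True) with
  | done => simp [encDS, encS, dual]
  | send T S ihT ihS =>
      constructor <;> (simp only [encDS, encS, dual]; rw [ihS.1])
  | recv T S ihT ihS =>
      constructor <;> (simp only [encDS, encS, dual]; rw [ihS.2])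
  | sel I f ih =>
      have h1 : (fun i h => encDS (f i h)) = (fun i h => encS (dual (f i h))) := by
        funext i h; exact (ih i h).1
      constructor <;> (simp only [encDS, encS, dual]; rw [h1])
  | bra I f ih =>
      have h2 : (fun i h => encDS (dual (f i h))) = (fun i h => encS (f i h)) := by
        funext i h; exact (ih i h).2
      constructor <;> (simp only [encDS, encS, dual]; rw [h2])
  | session S ih => trivial
  | chan T ih => trivial
  | unit => trivial

mutual
/-- Session subtyping `<:` (branch covariant in breadth and depth;
select contravariant in breadth, covariant in depth; output contravariant
in the payload; channel types invariant). -/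
inductive SessSub : SType → SType → Prop
  | done : SessSub .done .done
  | send : ∀ {T T' : Ty} {S S' : SType},
      TySub T' T → SessSub S S' → SessSub (.send T S) (.send T' S')
  | recv : ∀ {T T' : Ty} {S S' : SType},
      TySub T T' → SessSub S S' → SessSub (.recv T S) (.recv T' S')
  | bra : ∀ {I J : Finset ℕ} {f : ∀ i ∈ I, SType} {g : ∀ j ∈ J, SType}
      (hIJ : I ⊆ J), (∀ i (h : i ∈ I), SessSub (f i h) (g i (hIJ h))) →
      SessSub (.bra I f) (.bra J g)
  | sel : ∀ {I J : Finset ℕ} {f : ∀ i ∈ I, SType} {g : ∀ j ∈ J, SType}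
      (hJI : J ⊆ I), (∀ j (h : j ∈ J), SessSub (f j (hJI h)) (g j h)) →
      SessSub (.sel I f) (.sel J g)

/-- Subtyping on session-π types. -/
inductive TySub : Ty → Ty → Prop
  | session : ∀ {S S' : SType}, SessSub S S' → TySub (.session S) (.session S')
  | chan : ∀ {T T' : Ty}, TySub T T' → TySub T' T → TySub (.chan T) (.chan T')
  | unit : TySub .unit .unit
end

/-- Subtyping `≤` on standard linear π-types (linear input covariant, linear
output contravariant, variants covariant in breadth and depth, connections
invariant). -/
inductive PiSub : PiTy → PiTy → Prop
  | noCap : PiSub .noCap .noCap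
  | lin : ∀ {n : ℕ} {ts ts' : Fin n → PiTy},
      (∀ i, PiSub (ts i) (ts' i)) → PiSub (.lin n ts) (.lin n ts')
  | lout : ∀ {n : ℕ} {ts ts' : Fin n → PiTy},
      (∀ i, PiSub (ts' i) (ts i)) → PiSub (.lout n ts) (.lout n ts')
  | variant : ∀ {I J : Finset ℕ} {ts : ∀ i ∈ I, PiTy} {ts' : ∀ j ∈ J, PiTy}
      (hIJ : I ⊆ J), (∀ i (h : i ∈ I), PiSub (ts i h) (ts' i (hIJ h))) →
      PiSub (.variant I ts) (.variant J ts')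
  | conn : ∀ {n : ℕ} {ts : Fin n → PiTy}, PiSub (.conn n ts) (.conn n ts)
  | unit : PiSub .unit .unit

theorem PiSub.antisymm {a b : PiTy} (hab : PiSub a b) (hba : PiSub b a) : a = b := by
  induction hab with
  | noCap => rfl
  | unit => rfl
  | conn => rfl
  | lin _ ih =>
      cases hba with
      | lin h' => exact congrArg _ (funext fun i => ih i (h' i))
  | lout _ ih =>
      cases hba with
      | lout h' => exact congrArg _ (funext fun i => (ih i (h' i)).symm)
  | variant hIJ _ ih =>
      cases hba with
      | variant hJI h' =>
          obtain rfl := Finset.Subset.antisymm hIJ hJI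
          exact congrArg _ (funext fun i => funext fun hi => ih i hi (h' i hi))

theorem TySub.enc {T T' : Ty} (h : TySub T T') : PiSub (encTy T) (encTy T') := by
  induction h using TySub.rec
    (motive_1 := fun S S' _ => PiSub (encS S) (encS S') ∧ PiSub (encDS S') (encDS S)) with
  | done => simpa only [encS, encDS, and_self] using PiSub.noCap
  | send _ _ hT hS =>
      simp only [encS, encDS]
      exact ⟨.lout (Fin.forall_fin_two.2 ⟨hT, hS.2⟩), .lin (Fin.forall_fin_two.2 ⟨hT, hS.2⟩)⟩
  | recv _ _ hT hS =>
      simp only [encS, encDS]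
      exact ⟨.lin (Fin.forall_fin_two.2 ⟨hT, hS.1⟩), .lout (Fin.forall_fin_two.2 ⟨hT, hS.1⟩)⟩
  | @bra I J f g hIJ _ hf =>
      simp only [encS, encDS]
      have hv : PiSub (.variant I fun i hi => encS (f i hi))
          (.variant J fun j hj => encS (g j hj)) := .variant hIJ fun i hi => (hf i hi).1
      exact ⟨.lin (Fin.forall_fin_one.2 hv), .lout (Fin.forall_fin_one.2 hv)⟩
  | @sel I J f g hJI _ hf =>
      simp only [encS, encDS]
      have hv : PiSub (.variant J fun j hj => encDS (g j hj))
          (.variant I fun i hi => encDS (f i hi)) := .variant hJI fun j hj => (hf j hj).2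
      exact ⟨.lout (Fin.forall_fin_one.2 hv), .lin (Fin.forall_fin_one.2 hv)⟩
  | session _ hS => simpa only [encTy] using hS.1
  | chan _ _ h₁ h₂ =>
      simp only [encTy, h₁.antisymm h₂]
      exact .conn
  | unit => simpa only [encTy] using PiSub.unit

/-- The encoding preserves subtyping: if `T <: T'` in the session subtyping
relation, then `⟦T⟧ ≤ ⟦T'⟧` in the subtyping relation of the linear π-calculus. -/
theorem enc_preserves_subtyping (T T' : Ty) (h : TySub T T') :
    PiSub (encTy T) (encTy T') :=
  h.enc

end SessionPi
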